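/- Let d ≥ 2 be an integer and ε : ℤ/d → ℚ a function such that ∑_{a=1}^{d-1} ε(a) · ⟨aλ⟩ = 0 for every unit λ of ℤ/d, where ⟨x⟩ denotes the representative of x ∈ ℤ/d in {0, …, d-1}. Then for every unit λ of ℤ/d, the positive real number ∏_{a=1}^{d-1} Γ(1 − a/d)^{ε(a/λ)} (real powers of the positive real Gamma values, with a/λ computed in ℤ/d) is algebraic over ℚ. -/

import Mathlib

section KoHelpers
open Complex Real Filter Topology

lemma ko_pow_diff {n : ℕ} (hn : 1 ≤ n) {σ u v : ℝ} (h1 : 1 ≤ σ) (h2 : σ ≤ 2)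
    (hu : (n:ℝ) ≤ u) (hu' : u ≤ n + 1) (hv : (n:ℝ) ≤ v) (hv' : v ≤ n + 1) :
    |1 / u ^ σ - 1 / v ^ σ| ≤ 2 / (n:ℝ) ^ 2 := by
  have hn' : (1:ℝ) ≤ n := by exact_mod_cast hn
  have key : ∀ w : ℝ, (n:ℝ) ≤ w → w ≤ n + 1 → 1 / ((n:ℝ) + 1) ^ σ ≤ 1 / w ^ σ ∧ 1 / w ^ σ ≤ 1 / (n:ℝ) ^ σ := by
    intro w hw hw'
    have hw0 : 0 < w := by linarith
    constructor
    · gcongr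
    · gcongr
  have hk : 1 / (n:ℝ) ^ σ - 1 / ((n:ℝ) + 1) ^ σ ≤ 2 / (n:ℝ) ^ 2 := by
    have e1 : 1 / ((n:ℝ) + 1) ^ σ = 1 / (n:ℝ) ^ σ * ((n:ℝ) / (n + 1)) ^ σ := by
      rw [Real.div_rpow (by positivity) (by positivity)]
      field_simp
    have e2 : ((n:ℝ) / (n + 1)) ^ (2:ℝ) ≤ ((n:ℝ) / (n + 1)) ^ σ :=
      Real.rpow_le_rpow_of_exponent_ge (by positivity) (by rw [div_le_one (by positivity)]; linarith) h2
    rw [Real.rpow_two] at e2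
    have e3 : 1 / (n:ℝ) ^ σ ≤ 1 / n := by
      have := Real.rpow_le_rpow_of_exponent_le hn' h1
      rw [Real.rpow_one] at this
      gcongr
    have e5 : 1 - ((n:ℝ) / (n + 1)) ^ 2 ≤ 2 / n := by
      have : 1 - ((n:ℝ) / (n + 1)) ^ 2 = (2 * n + 1) / (n + 1) ^ 2 := by field_simp; ring
      rw [this, div_le_div_iff₀ (by positivity) (by positivity)]
      nlinarith
    have e4 : 0 ≤ 1 - ((n:ℝ) / (n + 1)) ^ 2 := by
      rw [sub_nonneg]
      apply pow_le_one₀ (by positivity)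
      rw [div_le_one (by positivity)]; linarith
    rw [e1]
    calc 1 / (n:ℝ) ^ σ - 1 / (n:ℝ) ^ σ * ((n:ℝ) / (n + 1)) ^ σ
        = 1 / (n:ℝ) ^ σ * (1 - ((n:ℝ) / (n + 1)) ^ σ) := by ring
      _ ≤ 1 / (n:ℝ) ^ σ * (1 - ((n:ℝ) / (n + 1)) ^ 2) := by gcongr
      _ ≤ 1 / n * (2 / n) := by gcongr
      _ = 2 / (n:ℝ) ^ 2 := by field_simp
  obtain ⟨a1, a2⟩ := key u hu hu'
  obtain ⟨b1, b2⟩ := key v hv hv'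
  rw [abs_le]
  constructor <;> linarith

lemma ko_hzo_one {a : ℝ} (h0 : 0 < a) (h1 : a < 1) :
    HurwitzZeta.hurwitzZetaOdd (a : UnitAddCircle) 1 = π / 2 * Complex.cot (π * a) := by
  let F : ℝ → ℕ → ℝ := fun σ n => (1 / (n + a) ^ σ - 1 / (n + 1 - a) ^ σ) / 2
  let C : ℝ := 1 / a ^ 2 + 1 / (1 - a) ^ 2 
  have ha' : 0 < 1 - a := by linarith
  have hbs : Summable (fun n : ℕ => 2 / (n:ℝ) ^ 2 + if n = 0 then C else 0) := by
    apply Summable.add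
    · have := (Real.summable_one_div_nat_pow (p := 2)).2 (by norm_num)
      simpa [div_eq_mul_inv] using this.mul_left 2
    · exact summable_of_ne_finset_zero (s := {0}) (by intro b hb; simp at hb; simp [hb])
  have hbound : ∀ σ : ℝ, 1 ≤ σ → σ ≤ 2 → ∀ n : ℕ, ‖F σ n‖ ≤ 2 / (n:ℝ) ^ 2 + if n = 0 then C else 0 := by
    intro σ hσ hσ' n
    rcases Nat.eq_zero_or_pos n with rfl | hn
    · simp only [F, C, Nat.cast_zero, zero_add, if_true, Real.norm_eq_abs]
      have k : ∀ w : ℝ, 0 < w → w < 1 → 0 < 1 / w ^ σ ∧ 1 / w ^ σ ≤ 1 / w ^ 2 := by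
        intro w hw hw'
        refine ⟨by positivity, ?_⟩
        have := Real.rpow_le_rpow_of_exponent_ge hw hw'.le hσ'
        rw [Real.rpow_two] at this
        gcongr
      obtain ⟨c1, c2⟩ := k a h0 h1
      obtain ⟨c3, c4⟩ := k (1 - a) ha' (by linarith)
      rw [abs_le]
      have z : (2:ℝ) / 0 ^ 2 = 0 := by norm_num
      rw [z, zero_add]
      constructor <;> linarith
    · have := ko_pow_diff hn (u := n + a) (v := n + 1 - a) hσ hσ' (by linarith) (by linarith) (by linarith) (by linarith)
      have hn0 : n ≠ 0 := by omega
      simp only [F, Real.norm_eq_abs, hn0, if_false, add_zero, abs_div, abs_two]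
      have := abs_nonneg (1 / (n + a) ^ σ - 1 / (n + 1 - a) ^ σ)
      linarith
  have hlim : Tendsto (fun σ : ℝ => ∑' n, F σ n) (𝓝[>] 1) (𝓝 (∑' n, F 1 n)) := by
    apply tendsto_tsum_of_dominated_convergence hbs
    · intro n
      have : ContinuousAt (fun σ : ℝ => F σ n) 1 := by
        have p1 : 0 < (n:ℝ) + a := by positivity
        have p2 : 0 < (n:ℝ) + 1 - a := by have : (0:ℝ) ≤ n := by positivity
                                          linarith
        have c1 : ContinuousAt (fun σ : ℝ => ((n:ℝ) + a) ^ σ) 1 := (Real.continuous_const_rpow p1.ne').continuousAt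
        have c2 : ContinuousAt (fun σ : ℝ => ((n:ℝ) + 1 - a) ^ σ) 1 := (Real.continuous_const_rpow p2.ne').continuousAt
        exact ((continuousAt_const.div c1 (by positivity)).sub (continuousAt_const.div c2 (by positivity))).div_const 2
      exact this.tendsto.mono_left nhdsWithin_le_nhds
    · have : Set.Ioo (1:ℝ) 2 ∈ 𝓝[>] (1:ℝ) := Ioo_mem_nhdsGT (by norm_num)
      filter_upwards [this] with σ hσ n
      exact hbound σ hσ.1.le hσ.2.le n
  have hval : ∀ σ : ℝ, 1 < σ → HurwitzZeta.hurwitzZetaOdd (a : UnitAddCircle) σ = ((∑' n, F σ n : ℝ) : ℂ) := by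
    intro σ hσ
    have := HurwitzZeta.hasSum_nat_hurwitzZetaOdd_of_mem_Icc (a := a) ⟨h0.le, h1.le⟩ (s := (σ:ℂ)) (by simpa using hσ)
    rw [← this.tsum_eq, Complex.ofReal_tsum]
    congr 1
    ext n
    have p2 : 0 ≤ (n:ℝ) + 1 - a := by have : (0:ℝ) ≤ n := by positivity
                                      linarith
    simp only [F]
    push_cast
    rw [Complex.ofReal_cpow (by positivity), Complex.ofReal_cpow p2]
    push_cast
    rfl
  have hcont : Tendsto (fun σ : ℝ => HurwitzZeta.hurwitzZetaOdd (a : UnitAddCircle) (σ:ℂ)) (𝓝[>] 1)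
      (𝓝 (HurwitzZeta.hurwitzZetaOdd (a : UnitAddCircle) 1)) := by
    have c : Continuous (fun σ : ℝ => HurwitzZeta.hurwitzZetaOdd (a : UnitAddCircle) (σ:ℂ)) :=
      (HurwitzZeta.differentiable_hurwitzZetaOdd _).continuous.comp Complex.continuous_ofReal
    have := (c.tendsto 1).mono_left (nhdsWithin_le_nhds (s := Set.Ioi 1))
    simpa using this
  have e1 : HurwitzZeta.hurwitzZetaOdd (a : UnitAddCircle) 1 = ((∑' n, F 1 n : ℝ) : ℂ) := by
    apply tendsto_nhds_unique hcont
    have := (Complex.continuous_ofReal.tendsto _).comp hlim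
    refine this.congr' ?_
    filter_upwards [self_mem_nhdsWithin] with σ hσ
    exact (hval σ hσ).symm
  have hs1 : Summable (F 1) := Summable.of_norm_bounded hbs (hbound 1 le_rfl (by norm_num))
  have hac : (a:ℂ) ∈ Complex.integerComplement := by
    rintro ⟨m, hm⟩
    have hm' : (m:ℝ) = a := by exact_mod_cast hm
    rw [← hm'] at h0 h1
    have : (0:ℤ) < m := by exact_mod_cast h0
    have : (m:ℤ) < 1 := by exact_mod_cast h1
    omega
  have hcot := cot_series_rep' hac
  have hs2 : Summable (fun n : ℕ => (1 / ((a:ℂ) - (n + 1)) + 1 / ((a:ℂ) + (n + 1)))) := by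
    have := summable_cotTerm hac
    simpa [cotTerm] using this
  have t1 : Tendsto (fun M => ∑ n ∈ Finset.range M, ((F 1 n : ℝ) : ℂ)) atTop (𝓝 ((∑' n, F 1 n : ℝ) : ℂ)) := by
    have := (Complex.continuous_ofReal.tendsto _).comp hs1.hasSum.tendsto_sum_nat
    refine this.congr ?_
    intro M; simp
  have t2 := hs2.hasSum.tendsto_sum_nat
  rw [← hcot] at t2
  have t3 : Tendsto (fun M : ℕ => 1 / ((a:ℂ) + M)) atTop (𝓝 0) := by
    have : Tendsto (fun M : ℕ => 1 / (a + M)) atTop (𝓝 (0:ℝ)) := by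
      apply Tendsto.div_atTop tendsto_const_nhds
      exact tendsto_atTop_add_const_left _ _ tendsto_natCast_atTop_atTop
    have := (Complex.continuous_ofReal.tendsto _).comp this
    simpa [Function.comp_def] using this
  have hfin : ∀ M : ℕ, ∑ n ∈ Finset.range M, ((F 1 n : ℝ) : ℂ) =
      (∑ n ∈ Finset.range M, (1 / ((a:ℂ) - (n + 1)) + 1 / ((a:ℂ) + (n + 1))) + 1 / a - 1 / ((a:ℂ) + M)) / 2 := by
    intro M
    induction M with
    | zero => simp
    | succ M ih =>
      rw [Finset.sum_range_succ, Finset.sum_range_succ, ih]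
      simp only [F, Real.rpow_one]
      push_cast
      have : (1:ℂ) / (M + 1 - a) = - (1 / (a - (M + 1))) := by
        rw [← neg_sub, one_div, one_div, inv_neg]
      rw [this, add_comm (M:ℂ) (a:ℂ)]
      ring
  rw [e1]
  apply tendsto_nhds_unique t1
  have t4 := ((t2.add_const (1 / (a:ℂ))).sub t3).div_const 2
  refine (t4.congr fun M => (hfin M).symm).trans ?_
  apply le_of_eq
  congr 1
  ring


lemma ko_sum_val {M : Type*} [AddCommMonoid M] {d : ℕ} [NeZero d] (g : ℕ → M) :
    ∑ a : ZMod d, g a.val = ∑ i ∈ Finset.range d, g i := by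
  refine Finset.sum_bij' (fun a _ => a.val) (fun i _ => (i : ZMod d)) ?_ ?_ ?_ ?_ ?_
  · intro a _; simpa using ZMod.val_lt a
  · intro a _; simp
  · intro a _; simp
  · intro i hi; simp at hi; exact ZMod.val_cast_of_lt hi
  · intro a _; rfl

/-- The first Bernoulli distribution on `ℤ/d`. -/
noncomputable def koB (d : ℕ) (a : ZMod d) : ℝ := if a = 0 then 0 else (a.val : ℝ) / d - 1 / 2

lemma ko_arith_geom (z : ℂ) (N : ℕ) :
    (z - 1) * ∑ j ∈ Finset.range N, (j:ℂ) * z ^ j = N * z ^ N - z * ∑ j ∈ Finset.range N, z ^ j := by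
  induction N with
  | zero => simp
  | succ N ih =>
    rw [Finset.sum_range_succ, mul_add, ih, Finset.sum_range_succ]
    push_cast
    ring

lemma ko_dft {N : ℕ} [NeZero N] (k : ZMod N) (hk : k ≠ 0) :
    ∑ j : ZMod N, (koB N j : ℂ) * ZMod.stdAddChar (j * k) =
      - I / 2 * Complex.cot (π * ((k.val / N : ℝ) : ℂ)) := by
  have hN : (N:ℂ) ≠ 0 := by exact_mod_cast NeZero.ne N
  set z : ℂ := ZMod.stdAddChar k with hz
  have hz1 : z ≠ 1 := by
    intro h
    apply hk
    apply ZMod.injective_stdAddChar (N := N)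
    rw [← hz, h, AddChar.map_zero_eq_one]
  have hpow : ∀ j : ZMod N, ZMod.stdAddChar (j * k) = z ^ j.val := by
    intro j
    rw [hz, ← AddChar.map_nsmul_eq_pow]
    congr 1
    rw [nsmul_eq_mul, ZMod.natCast_zmod_val]
  have hzN : z ^ N = 1 := by
    rw [hz, ← AddChar.map_nsmul_eq_pow]
    simp
  have hzexp : z = Complex.exp (2 * π * I * ((k.val / N : ℝ) : ℂ)) := by
    have := ZMod.stdAddChar_coe (N := N) (k.val : ℤ)
    simp only [Int.cast_natCast, ZMod.natCast_zmod_val] at this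
    rw [hz, this]
    congr 1
    push_cast
    ring
  have hsub : z - 1 ≠ 0 := sub_ne_zero.2 hz1
  have hS : ∑ j ∈ Finset.range N, z ^ j = 0 := by
    have := mul_geom_sum z N
    rw [hzN, sub_self] at this
    exact (mul_eq_zero.1 this).resolve_left hsub
  have hT : ∑ j ∈ Finset.range N, (j:ℂ) * z ^ j = N / (z - 1) := by
    have := ko_arith_geom z N
    rw [hS, hzN] at this
    rw [eq_div_iff hsub, mul_comm, this]; ring
  have e1 : ∀ j : ZMod N, (koB N j : ℂ) * ZMod.stdAddChar (j * k) =
      (fun i : ℕ => (1 / N : ℂ) * ((i:ℂ) * z ^ i) - 1 / 2 * z ^ i) j.val + if j = 0 then 1 / 2 else 0 := by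
    intro j
    rw [hpow]
    by_cases hj : j = 0
    · simp [hj, koB]
    · simp only [koB, hj, if_false]
      push_cast
      ring
  rw [Finset.sum_congr rfl (fun j _ => e1 j), Finset.sum_add_distrib, ko_sum_val (fun i : ℕ => (1 / N : ℂ) * ((i:ℂ) * z ^ i) - 1 / 2 * z ^ i),
    Finset.sum_sub_distrib, ← Finset.mul_sum, ← Finset.mul_sum, hS, hT, Complex.cot_pi_eq_exp_ratio, ← hzexp]
  have hsub' : 1 - z ≠ 0 := sub_ne_zero.2 hz1.symm
  simp
  field_simp
  ring

lemma ko_prim_ne_zero {N : ℕ} [NeZero N] (χ : DirichletCharacter ℂ N) (hp : χ.IsPrimitive)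
    (ho : χ.Odd) : ∑ j : ZMod N, χ j * koB N j ≠ 0 := by
  intro h0
  have hψo : (χ⁻¹).Odd := by
    have : χ (-1) = -1 := ho
    change χ⁻¹ (-1) = -1
    rw [MulChar.inv_apply_eq_inv', this]
    norm_num
  have hψp : (χ⁻¹).IsPrimitive := by
    rw [DirichletCharacter.isPrimitive_def, DirichletCharacter.conductor_inv]; exact hp
  have hψ1 : χ⁻¹ ≠ 1 := by
    intro h
    rw [h] at hψo
    have : (1 : DirichletCharacter ℂ N) (-1) = -1 := hψo
    rw [MulChar.one_apply (isUnit_one.neg)] at this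
    norm_num at this
  have hN1 : N ≠ 1 := by
    rintro rfl
    exact hψ1 (DirichletCharacter.level_one _)
  apply DirichletCharacter.LFunction_apply_one_ne_zero hψ1
  rw [DirichletCharacter.LFunction, ZMod.LFunction_def_odd hψo.to_fun]
  have e1 : ∀ k : ZMod N, χ⁻¹ k * HurwitzZeta.hurwitzZetaOdd (ZMod.toAddCircle k) 1 =
      π * I * ∑ j, (koB N j : ℂ) * (χ⁻¹ k * ZMod.stdAddChar (j * k)) := by
    intro k
    by_cases hk : k = 0
    · subst hk
      rw [DirichletCharacter.map_zero' _ hN1]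
      simp
    have hN0 : (0:ℝ) < N := by exact_mod_cast NeZero.pos N
    have hkv : 0 < k.val := Nat.pos_of_ne_zero (by simpa using hk)
    rw [ZMod.toAddCircle_apply, ko_hzo_one (by positivity)
      (by rw [div_lt_one hN0]; exact_mod_cast ZMod.val_lt k)]
    have := ko_dft k hk
    have e2 : ∑ j, (koB N j : ℂ) * (χ⁻¹ k * ZMod.stdAddChar (j * k)) =
      χ⁻¹ k * ∑ j, (koB N j : ℂ) * ZMod.stdAddChar (j * k) := by
      rw [Finset.mul_sum]; refine Finset.sum_congr rfl fun j _ => by ring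
    rw [e2, this]
    linear_combination (χ⁻¹ k * (π/2) * Complex.cot (π * ((k.val / N : ℝ) : ℂ))) * Complex.I_sq
  rw [Finset.sum_congr rfl (fun k _ => e1 k), ← Finset.mul_sum, Finset.sum_comm]
  have e3 : ∀ j : ZMod N, ∑ k, (koB N j : ℂ) * (χ⁻¹ k * ZMod.stdAddChar (j * k)) =
      (χ j * koB N j) * gaussSum χ⁻¹ (ZMod.stdAddChar (N := N)) := by
    intro j
    have := gaussSum_mulShift_of_isPrimitive (ZMod.stdAddChar (N := N)) hψp j
    rw [inv_inv] at this
    rw [← Finset.mul_sum, mul_comm (χ j), mul_assoc, ← this]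
    rfl
  rw [Finset.sum_congr rfl (fun k _ => e3 k), ← Finset.sum_mul, h0]
  simp


lemma ko_gauss_mul {n : ℕ} (hn : 0 < n) {x : ℝ} (hx : 0 < x) :
    (∏ k ∈ Finset.range n, Real.Gamma ((x + k) / n)) * (n:ℝ) ^ (x - 1) =
      (∏ k ∈ Finset.range n, Real.Gamma ((1 + k) / n)) * Real.Gamma x := by
  have hn' : (0:ℝ) < n := by exact_mod_cast hn
  set C := ∏ k ∈ Finset.range n, Real.Gamma ((1 + k) / n) with hC
  have hCpos : 0 < C := Finset.prod_pos fun k _ => Real.Gamma_pos_of_pos (by positivity)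
  clear_value C
  have hPpos : ∀ y : ℝ, 0 < y → 0 < ∏ k ∈ Finset.range n, Real.Gamma ((y + k) / n) := fun y hy =>
    Finset.prod_pos fun k _ => Real.Gamma_pos_of_pos (by positivity)
  let f : ℝ → ℝ := fun y => (∏ k ∈ Finset.range n, Real.Gamma ((y + k) / n)) * (n:ℝ) ^ (y - 1) / C
  have hf : Set.EqOn f Real.Gamma (Set.Ioi 0) := by
    apply Real.eq_Gamma_of_log_convex
    · have hcv : ConvexOn ℝ (Set.Ioi (0:ℝ)) (fun y : ℝ => ∑ k ∈ Finset.range n,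
          (Real.log ∘ Real.Gamma) ((y + k) / n) + ((y - 1) * Real.log n - Real.log C)) := by
        refine ConvexOn.add ?_ ?_
        · have hterm : ∀ k : ℕ, ConvexOn ℝ (Set.Ioi (0:ℝ)) (fun y : ℝ => (Real.log ∘ Real.Gamma) ((y + k) / n)) := by
            intro k
            refine ⟨convex_Ioi _, ?_⟩
            intro u hu v hv a b ha hb hab
            have hu' : (0:ℝ) < u := hu
            have hv' : (0:ℝ) < v := hv
            have := Real.convexOn_log_Gamma.2 (x := (u + k) / n) (y := (v + k) / n)
              (show (0:ℝ) < _ by positivity) (show (0:ℝ) < _ by positivity) ha hb hab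
            convert this using 2
            simp only [smul_eq_mul]
            field_simp
            linear_combination (-(k:ℝ)) * hab
          induction (Finset.range n) using Finset.induction_on with
          | empty => simpa using convexOn_const 0 (convex_Ioi (0:ℝ))
          | insert k s hk ih =>
            simp only [Finset.sum_insert hk]
            exact (hterm k).add ih
        · refine ⟨convex_Ioi _, ?_⟩
          intro u hu v hv a b ha hb hab
          apply le_of_eq
          simp only [smul_eq_mul]
          linear_combination (Real.log n + Real.log C) * hab
      refine hcv.congr ?_
      intro y hy
      have hy' : (0:ℝ) < y := hy
      simp only [f, Function.comp]
      rw [Real.log_div (by have := hPpos y hy'; positivity) hCpos.ne',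
        Real.log_mul (hPpos y hy').ne' (by positivity), Real.log_rpow hn',
        Real.log_prod (fun k _ => (Real.Gamma_pos_of_pos (by positivity)).ne')]
      ring
    · intro y hy
      simp only [f]
      have h1 : (∏ k ∈ Finset.range n, Real.Gamma ((y + 1 + k) / n)) * Real.Gamma (y / n) =
          (∏ k ∈ Finset.range n, Real.Gamma ((y + k) / n)) * Real.Gamma (y / n + 1) := by
        have a1 := Finset.prod_range_succ (fun k : ℕ => Real.Gamma ((y + k) / n)) n
        have a2 := Finset.prod_range_succ' (fun k : ℕ => Real.Gamma ((y + k) / n)) n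
        rw [a1] at a2
        have : (y + n) / n = y / n + 1 := by field_simp
        rw [this] at a2
        rw [a2]
        congr 1
        · refine Finset.prod_congr rfl fun k _ => ?_
          push_cast; ring_nf
        · simp
      rw [Real.Gamma_add_one (by positivity)] at h1
      have hg : 0 < Real.Gamma (y / n) := Real.Gamma_pos_of_pos (by positivity)
      have h2 : (∏ k ∈ Finset.range n, Real.Gamma ((y + 1 + k) / n)) =
          (∏ k ∈ Finset.range n, Real.Gamma ((y + k) / n)) * (y / n) := by
        apply mul_right_cancel₀ hg.ne'
        rw [h1]; ring
      have h3 : (n:ℝ) ^ (y + 1 - 1) = (n:ℝ) ^ (y - 1) * n := by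
        rw [← Real.rpow_add_one hn'.ne']; congr 1; ring
      rw [h2, h3]
      field_simp
    · intro y hy
      have := hPpos y hy
      simp only [f]
      positivity
    · simp only [f, sub_self, Real.rpow_zero, mul_one]
      rw [← hC]
      exact div_self hCpos.ne'
  have := hf hx
  simp only [f] at this
  rw [← this]
  field_simp

/-- Logarithms of positive algebraic numbers. -/
noncomputable def koW : Submodule ℚ ℝ where
  carrier := {x | IsAlgebraic ℚ (Real.exp x)}
  zero_mem' := by simpa using isAlgebraic_one
  add_mem' := by
    intro a b ha hb
    change IsAlgebraic ℚ (Real.exp (a + b))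
    rw [Real.exp_add]; exact IsAlgebraic.mul ha hb
  smul_mem' := by
    intro q x hx
    have hx' : IsAlgebraic ℚ (Real.exp x) := hx
    have hnat : ∀ n : ℕ, IsAlgebraic ℚ (Real.exp (n * x)) := by
      intro n
      rw [Real.exp_nat_mul]; exact hx'.pow n
    have hnum : IsAlgebraic ℚ (Real.exp (q.num * x)) := by
      rcases Int.eq_nat_or_neg q.num with ⟨n, h | h⟩
      · rw [h]; exact_mod_cast hnat n
      · rw [h]; push_cast; rw [neg_mul, Real.exp_neg]; exact (hnat n).inv
    change IsAlgebraic ℚ (Real.exp (q • x))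
    apply IsAlgebraic.of_pow q.den_pos
    rw [← Real.exp_nat_mul]
    convert hnum using 2
    rw [Rat.smul_def, ← mul_assoc]
    congr 1
    have := Rat.den_mul_eq_num q
    exact_mod_cast this

lemma ko_mem_W {x : ℝ} (hx : 0 < x) (h : IsAlgebraic ℚ x) : Real.log x ∈ koW := by
  change IsAlgebraic ℚ (Real.exp (Real.log x))
  rwa [Real.exp_log hx]

lemma ko_sin_alg (q : ℚ) : IsAlgebraic ℚ (Real.sin (π * q)) := by
  rw [mul_comm]
  exact (Real.isAlgebraic_sin_rat_mul_pi q).extendScalars (algebraMap ℤ ℚ).injective_int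

/-- Normalised `log Γ`. -/
noncomputable def koG (x : ℝ) : ℝ := Real.log (Real.Gamma x) - 1 / 2 * Real.log π

lemma ko_G_refl {x : ℝ} (hq : ∃ q : ℚ, x = q) (h0 : 0 < x) (h1 : x < 1) :
    koG x + koG (1 - x) ∈ koW := by
  obtain ⟨q, rfl⟩ := hq
  have hs : 0 < Real.sin (π * q) := Real.sin_pos_of_pos_of_lt_pi (by positivity)
    (by nlinarith [Real.pi_pos])
  have e : koG q + koG (1 - q) = - Real.log (Real.sin (π * q)) := by
    have h := Real.Gamma_mul_Gamma_one_sub (q:ℝ)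
    have g0 := Real.Gamma_pos_of_pos h0
    have g1 := Real.Gamma_pos_of_pos (sub_pos.2 h1)
    have h' := congrArg Real.log h
    rw [Real.log_mul g0.ne' g1.ne', Real.log_div Real.pi_pos.ne' hs.ne'] at h'
    unfold koG
    linarith
  rw [e]
  exact koW.neg_mem (ko_mem_W hs (ko_sin_alg q))

lemma ko_G_mul {x : ℝ} (hq : ∃ q : ℚ, x = q) (h0 : 0 < x) {n : ℕ} (hn : 0 < n) :
    ∑ k ∈ Finset.range n, koG ((x + k) / n) - koG x ∈ koW := by
  obtain ⟨q, rfl⟩ := hq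
  obtain ⟨m, rfl⟩ : ∃ m, n = m + 1 := ⟨n - 1, by omega⟩
  have hn' : (0:ℝ) < ((m + 1 : ℕ) : ℝ) := by positivity
  have h := congrArg Real.log (ko_gauss_mul hn h0)
  rw [Real.log_mul (Finset.prod_pos fun k _ => Real.Gamma_pos_of_pos (by positivity)).ne' (by positivity),
    Real.log_mul (Finset.prod_pos fun k _ => Real.Gamma_pos_of_pos (by positivity)).ne'
      (Real.Gamma_pos_of_pos h0).ne', Real.log_rpow hn',
    Real.log_prod (fun k _ => (Real.Gamma_pos_of_pos (by positivity)).ne'),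
    Real.log_prod (fun k _ => (Real.Gamma_pos_of_pos (by positivity)).ne'),
    Finset.sum_range_succ (fun k : ℕ => Real.log (Real.Gamma ((1 + (k:ℝ)) / (m + 1 : ℕ))))] at h
  have h1 : (1 + (m:ℝ)) / (m + 1 : ℕ) = 1 := by push_cast; field_simp; ring
  rw [h1, Real.Gamma_one, Real.log_one] at h
  set T := ∑ k ∈ Finset.range m, koG ((1 + (k:ℝ)) / (m + 1 : ℕ)) with hT
  have hT2 : (2:ℚ) • T ∈ koW := by
    have e : (2:ℚ) • T = ∑ k ∈ Finset.range m, (koG ((1 + (k:ℝ)) / (m + 1 : ℕ)) + koG (1 - (1 + (k:ℝ)) / (m + 1 : ℕ))) := by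
      have e2 : ∑ k ∈ Finset.range m, koG (1 - (1 + (k:ℝ)) / (m + 1 : ℕ)) = T := by
        rw [hT, ← Finset.sum_range_reflect]
        refine Finset.sum_congr rfl fun k hk => ?_
        congr 1
        have hk' : k < m := Finset.mem_range.1 hk
        have : ((m - 1 - k : ℕ) : ℝ) = m - 1 - k := by
          rw [Nat.sub_sub, Nat.cast_sub (by omega)]; push_cast; ring
        rw [this]
        push_cast
        field_simp
        ring
      rw [Finset.sum_add_distrib, e2, two_smul]
    rw [e]
    refine koW.sum_mem fun k hk => ko_G_refl ⟨(1 + k) / (m + 1 : ℕ), by push_cast; rfl⟩ (by positivity) ?_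
    have hk' : k < m := Finset.mem_range.1 hk
    rw [div_lt_one hn']
    have : (k:ℝ) < m := by exact_mod_cast hk'
    push_cast; linarith
  have hT1 : T ∈ koW := by
    have := koW.smul_mem (1/2 : ℚ) hT2
    rw [smul_smul] at this
    norm_num at this
    exact this
  have hlog : ((q - 1 : ℚ)) • Real.log ((m + 1 : ℕ) : ℝ) ∈ koW :=
    koW.smul_mem _ (ko_mem_W hn' (by simpa using isAlgebraic_algebraMap (R := ℚ) (A := ℝ) ((m + 1 : ℕ) : ℚ)))
  have e : ∑ k ∈ Finset.range (m + 1), koG ((q + k) / (m + 1 : ℕ)) - koG q =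
      T - ((q - 1 : ℚ)) • Real.log ((m + 1 : ℕ) : ℝ) := by
    rw [hT]
    unfold koG
    rw [Finset.sum_sub_distrib, Finset.sum_sub_distrib, Rat.smul_def]
    simp only [Finset.sum_const, Finset.card_range, nsmul_eq_mul]
    push_cast at h ⊢
    linear_combination h
  rw [e]
  exact koW.sub_mem hT1 hlog


/-- Odd distributions on `ℤ/d`. -/
def KoDist {d : ℕ} [NeZero d] (f : ZMod d → ℂ) : Prop :=
  (∀ a, f (-a) = - f a) ∧ ∀ p : ℕ, p.Prime → p ∣ d → ∀ c : ZMod d,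
    ∑ b with (p : ZMod d) * b = p * c, f b = f (p * c)

lemma ko_dist_of {d : ℕ} [NeZero d] (g : ℝ → ℂ)
    (h1 : ∀ x : ℝ, (∃ q : ℚ, x = q) → 0 < x → x < 1 → g x + g (1 - x) = 0)
    (h2 : ∀ x : ℝ, (∃ q : ℚ, x = q) → 0 < x → ∀ n : ℕ, 0 < n →
      ∑ k ∈ Finset.range n, g ((x + k) / n) = g x) :
    KoDist (fun a : ZMod d => if a = 0 then 0 else g ((a.val : ℝ) / d)) := by
  have hd : (0:ℝ) < d := by exact_mod_cast NeZero.pos d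
  have hodd : ∀ a : ZMod d, (if -a = 0 then 0 else g (((-a).val : ℝ) / d)) = - (if a = 0 then 0 else g ((a.val : ℝ) / d)) := by
    intro a
    by_cases ha : a = 0
    · simp [ha]
    · have ha' : -a ≠ 0 := neg_ne_zero.2 ha
      have hv : 0 < a.val := Nat.pos_of_ne_zero (by simpa using ha)
      have hlt := ZMod.val_lt a
      rw [if_neg ha, if_neg ha', eq_neg_iff_add_eq_zero, add_comm, ZMod.neg_val, if_neg ha, Nat.cast_sub hlt.le]
      have := h1 ((a.val : ℝ) / d) ⟨(a.val : ℚ) / d, by push_cast; rfl⟩ (by positivity)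
        (by rw [div_lt_one hd]; exact_mod_cast hlt)
      rwa [show ((d:ℝ) - a.val) / d = 1 - a.val / d by field_simp]
  refine ⟨hodd, ?_⟩
  rintro p hp ⟨e, he⟩ c
  beta_reduce
  have hp0 := hp.pos
  have he0 : 0 < e := Nat.pos_of_ne_zero (by rintro rfl; exact NeZero.ne d (by simpa using he))
  by_cases hc : (p : ZMod d) * c = 0
  · rw [hc, if_pos rfl]
    apply self_eq_neg.1
    rw [← Finset.sum_neg_distrib]
    refine Finset.sum_bij' (fun a _ => -a) (fun a _ => -a) ?_ ?_ ?_ ?_ ?_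
    · intro a ha; simpa using ha
    · intro a ha; simpa using ha
    · intro a _; simp
    · intro a _; simp
    · intro a _; rw [hodd, neg_neg]
  · have hr0 : 0 < ((p : ZMod d) * c).val := Nat.pos_of_ne_zero (by simpa using hc)
    have hrd := ZMod.val_lt ((p : ZMod d) * c)
    obtain ⟨t, ht⟩ : p ∣ ((p : ZMod d) * c).val := by
      rw [← ZMod.natCast_zmod_val c, ← Nat.cast_mul, ZMod.val_natCast]
      exact (Nat.dvd_mod_iff ⟨e, he⟩).2 (Dvd.intro _ rfl)
    have ht0 : 0 < t := by
      rcases Nat.eq_zero_or_pos t with h | h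
      · rw [h] at ht; omega
      · exact h
    have hte : t < e := by
      rw [ht] at hrd; rw [he] at hrd
      exact Nat.lt_of_mul_lt_mul_left hrd
    have hlt : ∀ k, k < p → t + k * e < d := by
      intro k hk
      rw [he]; nlinarith
    have hpc : (p : ZMod d) * c = ((p * t : ℕ) : ZMod d) := by
      rw [← ht, ZMod.natCast_zmod_val]
    have hpe : ((p * e : ℕ) : ZMod d) = 0 := by rw [← he]; simp
    have key := h2 (((p : ZMod d) * c).val / d) ⟨(((p : ZMod d) * c).val : ℚ) / d, by push_cast; rfl⟩
      (by positivity) p hp0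
    rw [if_neg hc, ← key]
    symm
    refine Finset.sum_bij' (fun k _ => ((t + k * e : ℕ) : ZMod d)) (fun b _ => b.val / e) ?_ ?_ ?_ ?_ ?_
    · intro k hk
      simp only [Finset.mem_filter, Finset.mem_univ, true_and]
      rw [hpc]
      have : (p : ZMod d) * ((t + k * e : ℕ) : ZMod d) = ((p * t : ℕ) : ZMod d) + k * ((p * e : ℕ) : ZMod d) := by
        push_cast; ring
      rw [this, hpe]; simp
    · intro b _
      rw [Finset.mem_range, Nat.div_lt_iff_lt_mul he0, ← he]
      exact ZMod.val_lt b
    · intro k hk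
      have := hlt k (Finset.mem_range.1 hk)
      rw [ZMod.val_cast_of_lt this, Nat.add_mul_div_right _ _ he0, Nat.div_eq_of_lt hte, zero_add]
    · intro b hb
      simp only [Finset.mem_filter, Finset.mem_univ, true_and] at hb
      rw [hpc] at hb
      have hm : p * b.val ≡ p * t [MOD p * e] := by
        rw [← he, ← ZMod.natCast_eq_natCast_iff]
        push_cast
        rw [ZMod.natCast_zmod_val, hb]; push_cast; rfl
      have hm' : b.val % e = t := by
        have := Nat.ModEq.mul_left_cancel' hp0.ne' hm
        rw [Nat.ModEq, Nat.mod_eq_of_lt hte] at this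
        exact this
      rw [← hm', mul_comm, Nat.mod_add_div, ZMod.natCast_zmod_val]
    · intro k hk
      have hkl := hlt k (Finset.mem_range.1 hk)
      have hne : ((t + k * e : ℕ) : ZMod d) ≠ 0 := by
        intro h
        have := congrArg ZMod.val h
        rw [ZMod.val_cast_of_lt hkl] at this
        simp at this
        omega
      rw [if_neg hne, ZMod.val_cast_of_lt hkl, ht, he]
      congr 1
      push_cast
      have : (p:ℝ) ≠ 0 := by exact_mod_cast hp0.ne'
      have : (e:ℝ) ≠ 0 := by exact_mod_cast he0.ne'
      field_simp

lemma ko_dist_B (d : ℕ) [NeZero d] : KoDist (fun a : ZMod d => (koB d a : ℂ)) := by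
  have := ko_dist_of (d := d) (fun x => ((x - 1 / 2 : ℝ) : ℂ)) ?_ ?_
  · convert this using 2 with a
    unfold koB
    split_ifs <;> simp
  · intro x _ _ _
    push_cast; ring
  · intro x _ _ n hn
    rw [← Complex.ofReal_sum, Complex.ofReal_inj]
    have hn' : (n:ℝ) ≠ 0 := by exact_mod_cast hn.ne'
    have := Finset.sum_range_id_mul_two n
    have h2 : (∑ i ∈ Finset.range n, (i:ℝ)) * 2 = n * (n - 1) := by
      have := congrArg (Nat.cast (R := ℝ)) this
      push_cast at this
      rw [this, Nat.cast_sub hn]; simp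
    rw [Finset.sum_sub_distrib, ← Finset.sum_div, Finset.sum_add_distrib]
    simp only [Finset.sum_const, Finset.card_range, nsmul_eq_mul]
    field_simp
    linear_combination h2

lemma ko_assoc {d : ℕ} [NeZero d] {a b : ZMod d} (h : addOrderOf a = addOrderOf b) :
    ∃ u : (ZMod d)ˣ, b = u * a := by
  have hord : ∀ (u : (ZMod d)ˣ) (g : ℕ), g ∣ d → addOrderOf ((u : ZMod d) * g) = d / g := by
    intro u g hg
    have : addOrderOf ((u : ZMod d) * g) = addOrderOf (g : ZMod d) :=
      addOrderOf_injective (AddMonoidHom.mulLeft (u : ZMod d)) (fun x y hxy => u.isUnit.mul_left_cancel hxy) _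
    rw [this, ZMod.addOrderOf_coe _ (NeZero.ne d), Nat.gcd_eq_right hg]
  obtain ⟨g1, hg1, u1, ⟨u1, rfl⟩, rfl⟩ := ZMod.eq_unit_mul_divisor a
  obtain ⟨g2, hg2, u2, ⟨u2, rfl⟩, rfl⟩ := ZMod.eq_unit_mul_divisor b
  rw [hord _ _ hg1, hord _ _ hg2] at h
  have hg : g1 = g2 := by
    rw [← Nat.div_div_self hg1 (NeZero.ne d), h, Nat.div_div_self hg2 (NeZero.ne d)]
  subst hg
  refine ⟨u2 * u1⁻¹, ?_⟩
  push_cast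
  rw [mul_assoc, Units.inv_mul_cancel_left]

lemma ko_unitsMap_eq_one {d : ℕ} [NeZero d] (a : ZMod d) (u : (ZMod d)ˣ) (hN : addOrderOf a ∣ d) :
    ZMod.unitsMap hN u = 1 ↔ (u : ZMod d) * a = a := by
  have hx : (u : ZMod d) * a = (u : ZMod d).val • a := by
    rw [nsmul_eq_mul, ZMod.natCast_zmod_val]
  have h1 : (u : ZMod d) * a = a ↔ (u : ZMod d).val • a = 1 • a := by rw [hx, one_nsmul]
  rw [h1, nsmul_eq_nsmul_iff_modEq, ← ZMod.natCast_eq_natCast_iff, ← Units.val_inj, ZMod.unitsMap_val,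
    ZMod.cast_eq_val]
  simp

lemma ko_det {d : ℕ} [NeZero d] (χ : DirichletCharacter ℂ d) (F : ZMod d → ℂ)
    (hD : KoDist F) (hχ : ∀ (u : (ZMod d)ˣ) (a : ZMod d), F (u * a) = χ u * F a)
    (h0 : F ((d / χ.conductor : ℕ) : ZMod d) = 0) : ∀ a, F a = 0 := by
  have hmd := χ.conductor_dvd_level
  suffices H : ∀ N : ℕ, ∀ a : ZMod d, addOrderOf a = N → F a = 0 from fun a => H _ a rfl
  intro N
  induction N using Nat.strong_induction_on with
  | _ N ih =>
  intro a ha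
  have hNd : addOrderOf a ∣ d := by
    have := addOrderOf_dvd_card (x := a)
    rwa [ZMod.card] at this
  have hNpos : 0 < addOrderOf a := addOrderOf_pos a
  by_cases hmN : χ.conductor ∣ addOrderOf a
  · by_cases heq : addOrderOf a = χ.conductor
    · have : addOrderOf ((d / χ.conductor : ℕ) : ZMod d) = addOrderOf a := by
        rw [ZMod.addOrderOf_coe _ (NeZero.ne d), Nat.gcd_eq_right (Nat.div_dvd_of_dvd hmd),
          Nat.div_div_self hmd (NeZero.ne d), heq]
      obtain ⟨u, hu⟩ := ko_assoc this
      rw [hu, hχ, h0, mul_zero]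
    · obtain ⟨q, hq⟩ := hmN
      have hq1 : q ≠ 1 := by rintro rfl; exact heq (by simpa using hq)
      obtain ⟨p, hp, r, rfl⟩ := Nat.exists_prime_and_dvd hq1
      have hpN : p ∣ addOrderOf a := ⟨χ.conductor * r, by rw [hq]; ring⟩
      have hpd : p ∣ d := hpN.trans hNd
      have hord : addOrderOf ((p : ZMod d) * a) = χ.conductor * r := by
        rw [← nsmul_eq_mul, addOrderOf_nsmul, Nat.gcd_eq_right hpN, hq]
        rw [show χ.conductor * (p * r) = p * (χ.conductor * r) by ring, Nat.mul_div_cancel_left _ hp.pos]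
      have hlt : χ.conductor * r < N := by
        have h1 : addOrderOf a = p * (χ.conductor * r) := by rw [hq]; ring
        rw [← ha, h1]
        have h2 : 0 < χ.conductor * r := by
          rw [h1] at hNpos; exact Nat.pos_of_mul_pos_left hNpos
        have := hp.two_le
        nlinarith
      have hdist := hD.2 p hp hpd a
      rw [ih _ hlt _ hord] at hdist
      have hb : ∀ b ∈ Finset.univ.filter (fun b : ZMod d => (p : ZMod d) * b = p * a),
          F b = if addOrderOf b = addOrderOf a then F a else 0 := by
        intro b hb
        simp only [Finset.mem_filter, Finset.mem_univ, true_and] at hb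
        split_ifs with hba
        · obtain ⟨u, rfl⟩ := ko_assoc hba.symm
          rw [hχ]
          have hfix : (u : ZMod d) * ((p : ZMod d) * a) = p * a :=
            (mul_left_comm _ _ _).trans hb
          have hd' : addOrderOf ((p : ZMod d) * a) ∣ d := by
            have := addOrderOf_dvd_card (x := (p : ZMod d) * a)
            rwa [ZMod.card] at this
          have hk := (ko_unitsMap_eq_one _ u hd').2 hfix
          have hft : χ.FactorsThrough (addOrderOf ((p : ZMod d) * a)) :=
            (χ.mem_conductorSet_iff_conductor_dvd hd').2 (hord ▸ Dvd.intro _ rfl)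
          have := (DirichletCharacter.factorsThrough_iff_ker_unitsMap hd').1 hft hk
          rw [MonoidHom.mem_ker] at this
          have h1 : χ u = 1 := by
            have := congrArg Units.val this
            simpa using this
          rw [h1, one_mul]
        · apply ih (addOrderOf b) _ b rfl
          rw [← ha]
          apply lt_of_le_of_ne _ hba
          apply Nat.le_of_dvd hNpos
          apply addOrderOf_dvd_of_nsmul_eq_zero
          obtain ⟨s, hs⟩ := hpN
          have : addOrderOf a • a = 0 := addOrderOf_nsmul_eq_zero a
          rw [hs, nsmul_eq_mul] at this ⊢
          push_cast at this ⊢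
          rw [mul_comm (p : ZMod d), mul_assoc] at this ⊢
          rw [hb, this]
      rw [Finset.sum_congr rfl hb, ← Finset.sum_filter, Finset.sum_const, nsmul_eq_mul] at hdist
      rcases mul_eq_zero.1 hdist with h | h
      · exfalso
        have h' := Nat.cast_eq_zero.1 h
        rw [Finset.card_eq_zero] at h'
        have : a ∈ (∅ : Finset (ZMod d)) := by rw [← h']; simp
        simp at this
      · exact h
  · have hnf : ¬ χ.FactorsThrough (addOrderOf a) := fun h =>
      hmN ((χ.mem_conductorSet_iff_conductor_dvd hNd).1 h)
    rw [DirichletCharacter.factorsThrough_iff_ker_unitsMap hNd, SetLike.not_le_iff_exists] at hnf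
    obtain ⟨u, hu, hu'⟩ := hnf
    have hfix := (ko_unitsMap_eq_one a u hNd).1 hu
    have hne : χ u ≠ 1 := by
      intro h
      apply hu'
      rw [MonoidHom.mem_ker, ← Units.val_inj]
      simpa using h
    have h3 := hχ u a
    rw [hfix] at h3
    have : (χ u - 1) * F a = 0 := by rw [sub_mul, ← h3]; ring
    exact (mul_eq_zero.1 this).resolve_left (sub_ne_zero.2 hne)


/-- The `χ`-component of a function on `ℤ/d`. -/
noncomputable def koP {d : ℕ} [NeZero d] (χ : DirichletCharacter ℂ d) (f : ZMod d → ℂ) (a : ZMod d) : ℂ :=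
  ∑ u : (ZMod d)ˣ, χ ((u⁻¹ : (ZMod d)ˣ) : ZMod d) * f (u * a)

lemma ko_dist_lin {d : ℕ} [NeZero d] {ι : Type*} (s : Finset ι) (c : ι → ℂ) (f : ι → ZMod d → ℂ)
    (hf : ∀ i, KoDist (f i)) : KoDist (fun a => ∑ i ∈ s, c i * f i a) := by
  constructor
  · intro a
    rw [← Finset.sum_neg_distrib]
    refine Finset.sum_congr rfl fun i _ => ?_
    rw [(hf i).1]; ring
  · intro p hp hpd x
    rw [Finset.sum_comm]
    refine Finset.sum_congr rfl fun i _ => ?_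
    rw [← Finset.mul_sum, (hf i).2 p hp hpd]

lemma ko_dist_unit {d : ℕ} [NeZero d] {f : ZMod d → ℂ} (hf : KoDist f) (u : (ZMod d)ˣ) :
    KoDist (fun a : ZMod d => f ((u : ZMod d) * a)) := by
  constructor
  · intro a
    beta_reduce
    rw [mul_neg, hf.1]
  · intro p hp hpd x
    have := hf.2 p hp hpd (u * x)
    beta_reduce
    rw [mul_left_comm, ← this]
    refine Finset.sum_bij' (fun a _ => (u : ZMod d) * a) (fun a _ => ((u⁻¹ : (ZMod d)ˣ) : ZMod d) * a) ?_ ?_ ?_ ?_ ?_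
    · intro a ha
      simp only [Finset.mem_filter, Finset.mem_univ, true_and] at ha ⊢
      rw [mul_left_comm, ha, mul_left_comm]
    · intro a ha
      simp only [Finset.mem_filter, Finset.mem_univ, true_and] at ha ⊢
      rw [mul_left_comm, ha, mul_left_comm, Units.inv_mul_cancel_left]
    · intro a _; simp
    · intro a _; simp
    · intro a _; rfl

lemma ko_P_dist {d : ℕ} [NeZero d] {f : ZMod d → ℂ} (hf : KoDist f) (χ : DirichletCharacter ℂ d) :
    KoDist (koP χ f) :=
  ko_dist_lin _ _ (fun (u : (ZMod d)ˣ) (a : ZMod d) => f ((u : ZMod d) * a)) (fun u => ko_dist_unit hf u)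

lemma ko_P_equiv {d : ℕ} [NeZero d] (f : ZMod d → ℂ) (χ : DirichletCharacter ℂ d)
    (v : (ZMod d)ˣ) (a : ZMod d) : koP χ f (v * a) = χ v * koP χ f a := by
  unfold koP
  rw [Finset.mul_sum]
  refine Fintype.sum_equiv (Equiv.mulRight v) _ _ fun u => ?_
  simp only [Equiv.coe_mulRight, mul_inv_rev, Units.val_mul, map_mul]
  have : χ v * χ ((v⁻¹ : (ZMod d)ˣ) : ZMod d) = 1 := by
    rw [← map_mul, Units.mul_inv, map_one]
  rw [mul_assoc (u : ZMod d)]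
  linear_combination (-(χ ((u⁻¹ : (ZMod d)ˣ) : ZMod d)) * f (u * (v * a))) * this

lemma ko_P_sum {d : ℕ} [NeZero d] (f : ZMod d → ℂ) (a : ZMod d) :
    ∑ χ : DirichletCharacter ℂ d, koP χ f a = d.totient * f a := by
  unfold koP
  rw [Finset.sum_comm]
  have : ∀ u : (ZMod d)ˣ, ∑ χ : DirichletCharacter ℂ d, χ ((u⁻¹ : (ZMod d)ˣ) : ZMod d) * f (u * a) =
      if u = 1 then (d.totient : ℂ) * f a else 0 := by
    intro u
    rw [← Finset.sum_mul, DirichletCharacter.sum_characters_eq]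
    by_cases hu : u = 1
    · simp [hu]
    · have : ((u⁻¹ : (ZMod d)ˣ) : ZMod d) ≠ 1 := by simpa using hu
      simp [hu, this]
  rw [Finset.sum_congr rfl fun u _ => this u]
  simp

lemma ko_sum_fiber {G H : Type*} [Group G] [Group H] [Fintype G] [Fintype H]
    (φ : G →* H) (hφ : Function.Surjective φ) (K : H → ℂ) (hK : ∑ h, K h ≠ 0) :
    ∑ g, K (φ g) ≠ 0 := by
  classical
  have e : ∑ g, K (φ g) = ∑ h, ((Finset.univ.filter (fun g => φ g = h)).card : ℂ) * K h := by
    rw [← Finset.sum_fiberwise Finset.univ φ]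
    refine Finset.sum_congr rfl fun h _ => ?_
    rw [← nsmul_eq_mul, ← Finset.sum_const]
    refine Finset.sum_congr rfl fun g hg => ?_
    rw [(Finset.mem_filter.1 hg).2]
  have e2 : ∀ h : H, (Finset.univ.filter (fun g => φ g = h)).card = (Finset.univ.filter (fun g => φ g = 1)).card :=
    fun h => MonoidHom.card_fiber_eq_of_mem_range φ (hφ h) (hφ 1)
  rw [e, Finset.sum_congr rfl fun h _ => by rw [e2 h], ← Finset.mul_sum]
  refine mul_ne_zero ?_ hK
  have : (1 : G) ∈ Finset.univ.filter (fun g => φ g = 1) := by simp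
  exact_mod_cast Finset.card_ne_zero_of_mem this

lemma ko_B_level {d m : ℕ} [NeZero d] (hm : m ∣ d) (x : ZMod d) :
    koB d (x * ((d / m : ℕ) : ZMod d)) = koB m (x.cast : ZMod m) := by
  obtain ⟨e, rfl⟩ := hm
  have hme : m * e ≠ 0 := NeZero.ne (m * e)
  have hm0 : m ≠ 0 := left_ne_zero_of_mul hme
  have he0 : e ≠ 0 := right_ne_zero_of_mul hme
  have : NeZero m := ⟨hm0⟩
  rw [Nat.mul_div_cancel_left _ (Nat.pos_of_ne_zero hm0)]
  have h1 : (x * (e : ZMod (m * e))).val = (x.val % m) * e := by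
    rw [← ZMod.natCast_zmod_val x, ← Nat.cast_mul, ZMod.val_natCast, Nat.mul_mod_mul_right,
      ZMod.natCast_zmod_val]
  have h2 : (x.cast : ZMod m).val = x.val % m := by
    rw [ZMod.cast_eq_val, ZMod.val_natCast]
  have h3 : x * (e : ZMod (m * e)) = 0 ↔ (x.cast : ZMod m) = 0 := by
    rw [← ZMod.val_eq_zero, ← ZMod.val_eq_zero (x.cast : ZMod m), h1, h2]
    simp [he0]
  unfold koB
  simp only [h3, h1, h2]
  have : (m:ℝ) ≠ 0 := by exact_mod_cast hm0
  have : (e:ℝ) ≠ 0 := by exact_mod_cast he0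
  split_ifs
  · rfl
  · push_cast
    field_simp

lemma ko_PB_ne {d : ℕ} [NeZero d] (χ : DirichletCharacter ℂ d) (ho : χ.Odd) :
    koP χ (fun a => (koB d a : ℂ)) ((d / χ.conductor : ℕ) : ZMod d) ≠ 0 := by
  have hm := χ.conductor_dvd_level
  have : NeZero χ.conductor := ⟨χ.conductor_ne_zero⟩
  set ψ := χ.primitiveCharacter with hψ
  have hval : ∀ u : (ZMod d)ˣ, χ u = ψ (ZMod.unitsMap hm u) := by
    intro u
    conv_lhs => rw [← χ.changeLevel_primitiveCharacter]
    rw [DirichletCharacter.changeLevel_eq_cast_of_dvd]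
    rfl
  have hψo : (ψ⁻¹).Odd := by
    change ψ⁻¹ (-1) = -1
    have h1 := hval (-1)
    have : χ (-1) = -1 := ho
    have h2 : ZMod.unitsMap hm (-1) = -1 := by
      ext
      simp [ZMod.unitsMap_def]
    rw [h2] at h1
    push_cast at h1
    rw [this] at h1
    rw [MulChar.inv_apply_eq_inv', ← h1]
    norm_num
  have hψp : (ψ⁻¹).IsPrimitive := by
    rw [DirichletCharacter.isPrimitive_def, DirichletCharacter.conductor_inv]
    exact χ.primitiveCharacter_isPrimitive
  have key := ko_prim_ne_zero ψ⁻¹ hψp hψo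
  have key2 : ∑ v : (ZMod χ.conductor)ˣ, ψ⁻¹ v * koB χ.conductor v ≠ 0 := by
    convert key using 1
    refine Fintype.sum_of_injective (fun v : (ZMod χ.conductor)ˣ => (v : ZMod χ.conductor)) Units.val_injective _ _ ?_ ?_
    · intro i hi
      rw [MulChar.map_nonunit _ (fun h => hi ⟨h.unit, rfl⟩), zero_mul]
    · intro i; rfl
  have := ko_sum_fiber (ZMod.unitsMap hm) (ZMod.unitsMap_surjective hm)
    (fun v => ψ⁻¹ v * koB χ.conductor v) key2
  convert this using 1
  unfold koP
  refine Finset.sum_congr rfl fun u _ => ?_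
  beta_reduce
  rw [ko_B_level hm, hval, MulChar.inv_apply_eq_inv', map_inv, ZMod.unitsMap_val]
  congr 1
  apply eq_inv_of_mul_eq_one_left
  rw [← ZMod.unitsMap_val hm, ← map_mul, Units.inv_mul, map_one]

lemma ko_main {d : ℕ} [NeZero d] {f : ZMod d → ℂ} (hf : KoDist f) (δ : ZMod d → ℂ)
    (hδ : ∀ u : (ZMod d)ˣ, ∑ a, δ a * koB d (u * a) = 0) : ∑ a, δ a * f a = 0 := by
  have hcomp : ∀ χ : DirichletCharacter ℂ d, ∑ a, δ a * koP χ f a = 0 := by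
    intro χ
    rcases χ.even_or_odd with he | ho
    · have : ∀ a, koP χ f a = 0 := by
        intro a
        have h1 := (ko_P_dist hf χ).1 a
        have h2 := ko_P_equiv f χ (-1) a
        have h3 : χ (-1) = 1 := he
        push_cast at h2
        rw [h3, neg_one_mul, one_mul, h1] at h2
        exact self_eq_neg.1 h2.symm
      simp [this]
    · set H := koP χ (fun a => (koB d a : ℂ)) with hH
      set F := koP χ f with hF
      set x₀ : ZMod d := ((d / χ.conductor : ℕ) : ZMod d) with hx
      have hne : H x₀ ≠ 0 := ko_PB_ne χ ho
      have hHd : KoDist H := ko_P_dist (ko_dist_B d) χ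
      have hFd : KoDist F := ko_P_dist hf χ
      have hz : ∀ a, H x₀ * F a + (- F x₀) * H a = 0 := by
        apply ko_det χ
        · have := ko_dist_lin (Finset.univ : Finset (Fin 2)) ![H x₀, - F x₀] ![F, H]
            (by intro i; fin_cases i <;> simp [hHd, hFd])
          simpa [Fin.sum_univ_two] using this
        · intro u a
          rw [hF, hH, ko_P_equiv, ko_P_equiv]; ring
        · ring
      have hδH : ∑ a, δ a * H a = 0 := by
        simp only [hH, koP, Finset.mul_sum]
        rw [Finset.sum_comm]
        refine Finset.sum_eq_zero fun u _ => ?_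
        have := hδ u
        rw [← mul_zero (χ ((u⁻¹ : (ZMod d)ˣ) : ZMod d)), ← this, Finset.mul_sum]
        exact Finset.sum_congr rfl fun a _ => by ring
      apply (mul_eq_zero.1 _).resolve_left hne
      have : F x₀ * ∑ a, δ a * H a = 0 := by rw [hδH, mul_zero]
      rw [← this, Finset.mul_sum, Finset.mul_sum]
      refine Finset.sum_congr rfl fun a _ => ?_
      linear_combination δ a * hz a
  have htot : (d.totient : ℂ) ≠ 0 := by
    exact_mod_cast (Nat.totient_pos.2 (NeZero.pos d)).ne'
  apply (mul_eq_zero.1 _).resolve_left htot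
  rw [Finset.mul_sum]
  have : ∀ a, (d.totient : ℂ) * (δ a * f a) = ∑ χ : DirichletCharacter ℂ d, δ a * koP χ f a := by
    intro a
    rw [← Finset.mul_sum, ko_P_sum]; ring
  rw [Finset.sum_congr rfl fun a _ => this a, Finset.sum_comm]
  exact Finset.sum_eq_zero fun χ _ => hcomp χ

lemma ko_sum_Icc {M : Type*} [AddCommMonoid M] {d : ℕ} [NeZero d] (K : ZMod d → M) (h0 : K 0 = 0) :
    ∑ a ∈ Finset.Icc 1 (d - 1), K (a : ZMod d) = ∑ x, K x := by
  have h1 := ko_sum_val (d := d) (fun i : ℕ => K (i : ZMod d))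
  simp only [ZMod.natCast_zmod_val] at h1
  rw [h1]
  apply Finset.sum_subset
  · intro i hi
    have := NeZero.pos d
    simp only [Finset.mem_Icc, Finset.mem_range] at hi ⊢
    omega
  · intro i hi hi'
    simp only [Finset.mem_Icc, Finset.mem_range] at hi hi'
    have : i = 0 := by omega
    simp [this, h0]

lemma ko_dist_G {d : ℕ} [NeZero d] (φ : ℝ →ₗ[ℚ] ℚ) (hφ : koW ≤ LinearMap.ker φ) :
    KoDist (fun a : ZMod d => if a = 0 then 0 else ((φ (koG ((a.val : ℝ) / d)) : ℚ) : ℂ)) := by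
  apply ko_dist_of (fun x => ((φ (koG x) : ℚ) : ℂ))
  · intro x hq h0 h1
    have := hφ (ko_G_refl hq h0 h1)
    rw [LinearMap.mem_ker, map_add] at this
    exact_mod_cast this
  · intro x hq h0 n hn
    have := hφ (ko_G_mul hq h0 hn)
    rw [LinearMap.mem_ker, map_sub, map_sum, sub_eq_zero] at this
    exact_mod_cast this


end KoHelpers

/-- **Koblitz–Ogus.** If `ε : ℤ/d → ℚ` satisfies `∑_{a=1}^{d-1} ε(a)⟨aλ⟩ = 0`
for every unit `λ` of `ℤ/d`, then for every unit `λ` the real number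
`∏_{a=1}^{d-1} Γ(1 − a/d)^{ε(a/λ)}` is algebraic over `ℚ`. -/
theorem koblitz_ogus (d : ℕ) [NeZero d] (hd : 2 ≤ d) (ε : ZMod d → ℚ)
    (hε : ∀ lam : (ZMod d)ˣ, ∑ a ∈ Finset.Icc 1 (d - 1),
      ε (a : ZMod d) * ((((a : ZMod d) * (lam : ZMod d)).val : ℚ)) = 0)
    (lam : (ZMod d)ˣ) :
    IsAlgebraic ℚ (∏ a ∈ Finset.Icc 1 (d - 1),
      Real.Gamma (1 - (a : ℝ) / d) ^
        ((ε ((a : ZMod d) * ((lam⁻¹ : (ZMod d)ˣ) : ZMod d)) : ℝ))) := by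
  have hdR : (0:ℝ) < d := by exact_mod_cast NeZero.pos d
  have hdQ : (d:ℚ) ≠ 0 := by exact_mod_cast NeZero.ne d
  have H1 : ∀ v : (ZMod d)ˣ, ∑ x : ZMod d, ε x * ((x * (v : ZMod d)).val : ℚ) = 0 := by
    intro v
    rw [← hε v]
    exact (ko_sum_Icc (fun x : ZMod d => ε x * ((x * (v : ZMod d)).val : ℚ)) (by simp)).symm
  set η : ZMod d → ℚ := fun x => ε (x * ((lam⁻¹ : (ZMod d)ˣ) : ZMod d)) with hη
  have H2 : ∀ u : (ZMod d)ˣ, ∑ x : ZMod d, η x * ((x * (u : ZMod d)).val : ℚ) = 0 := by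
    intro u
    rw [← H1 (lam * u)]
    refine Fintype.sum_equiv (Units.mulRight lam⁻¹) _ _ fun x => ?_
    simp only [Units.mulRight_apply, hη]
    congr 3
    push_cast
    rw [mul_assoc, Units.inv_mul_cancel_left]
  have H3 : ∑ x : ZMod d, (if x = 0 then 0 else η x) = 0 := by
    have h1 := H2 1
    have h2 := H2 (-1)
    apply (mul_eq_zero.1 _).resolve_left hdQ
    have h3 := congrArg₂ (· + ·) h2 h1
    simp only [add_zero] at h3
    rw [← Finset.sum_add_distrib] at h3
    refine Eq.trans ?_ h3
    rw [Finset.mul_sum]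
    refine Finset.sum_congr rfl fun x _ => ?_
    by_cases hx : x = 0
    · simp [hx]
    · rw [if_neg hx]
      push_cast
      rw [mul_one, mul_neg_one, ZMod.neg_val, if_neg hx, Nat.cast_sub (ZMod.val_lt x).le]
      ring
  have H4 : ∀ u : (ZMod d)ˣ, ∑ x : ZMod d, (η x : ℂ) * koB d (u * x) = 0 := by
    intro u
    have e : ∀ x : ZMod d, (η x : ℂ) * koB d (u * x) =
        ((1 / (d:ℚ) * (η x * ((x * (u : ZMod d)).val : ℚ)) - 1 / 2 * (if x = 0 then 0 else η x) : ℚ) : ℂ) := by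
      intro x
      unfold koB
      by_cases hx : x = 0
      · simp [hx]
      · have : (u : ZMod d) * x ≠ 0 := by simpa using hx
        rw [if_neg hx, if_neg this, mul_comm (u : ZMod d)]
        push_cast
        ring
    rw [Finset.sum_congr rfl fun x _ => e x, ← Rat.cast_sum, Finset.sum_sub_distrib, ← Finset.mul_sum,
      ← Finset.mul_sum, H2 u, H3]
    simp
  have hpos : ∀ a ∈ Finset.Icc 1 (d - 1), 0 < Real.Gamma (1 - (a : ℝ) / d) := by
    intro a ha
    apply Real.Gamma_pos_of_pos
    rw [sub_pos, div_lt_one hdR]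
    have : a < d := by simp only [Finset.mem_Icc] at ha; omega
    exact_mod_cast this
  have hsumη : ∑ a ∈ Finset.Icc 1 (d - 1), η (a : ZMod d) = 0 := by
    rw [← H3, ← ko_sum_Icc (fun x : ZMod d => if x = 0 then (0:ℚ) else η x) (by simp)]
    refine Finset.sum_congr rfl fun a ha => ?_
    rw [if_neg]
    intro h
    simp only [Finset.mem_Icc] at ha
    rw [ZMod.natCast_eq_zero_iff] at h
    exact absurd (Nat.le_of_dvd (by omega) h) (by omega)
  have hW : ∑ a ∈ Finset.Icc 1 (d - 1), η (a : ZMod d) • koG (1 - (a : ℝ) / d) ∈ koW := by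
    by_contra hnot
    obtain ⟨φ, hφ, hker⟩ := Submodule.exists_le_ker_of_notMem hnot
    apply hφ
    have hf := ko_dist_G (d := d) φ hker
    have hm := ko_main hf (fun x => (η x : ℂ)) H4
    rw [map_sum]
    have e : ∀ a ∈ Finset.Icc 1 (d - 1), φ (η (a : ZMod d) • koG (1 - (a : ℝ) / d)) =
        (fun x : ZMod d => η x * if -x = 0 then 0 else φ (koG (((-x).val : ℝ) / d))) (a : ZMod d) := by
      intro a ha
      simp only [Finset.mem_Icc] at ha
      have hlt : a < d := by omega
      have hne : (a : ZMod d) ≠ 0 := by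
        intro h
        rw [ZMod.natCast_eq_zero_iff] at h
        exact absurd (Nat.le_of_dvd (by omega) h) (by omega)
      have hne' : -(a : ZMod d) ≠ 0 := neg_ne_zero.2 hne
      rw [map_smul, smul_eq_mul]
      simp only [if_neg hne']
      rw [ZMod.neg_val, if_neg hne, ZMod.val_cast_of_lt hlt, Nat.cast_sub hlt.le]
      congr 3
      field_simp
    rw [Finset.sum_congr rfl e, ko_sum_Icc (fun x : ZMod d => η x * if -x = 0 then (0:ℚ) else φ (koG (((-x).val : ℝ) / d))) (by simp)]
    have hcast : ((∑ x : ZMod d, η x * (if -x = 0 then 0 else φ (koG (((-x).val : ℝ) / d))) : ℚ) : ℂ) = 0 := by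
      rw [← neg_zero (G := ℂ), ← hm, ← Finset.sum_neg_distrib, Rat.cast_sum]
      refine Finset.sum_congr rfl fun x _ => ?_
      have h1 := hf.1 x
      beta_reduce at h1
      rw [← mul_neg, ← h1]
      split_ifs <;> simp
    exact_mod_cast hcast
  have hWa : IsAlgebraic ℚ (Real.exp (∑ a ∈ Finset.Icc 1 (d - 1), η (a : ZMod d) • koG (1 - (a : ℝ) / d))) := hW
  convert hWa using 1
  have e : ∑ a ∈ Finset.Icc 1 (d - 1), η (a : ZMod d) • koG (1 - (a : ℝ) / d) =
      ∑ a ∈ Finset.Icc 1 (d - 1), Real.log (Real.Gamma (1 - (a : ℝ) / d)) * (η (a : ZMod d) : ℝ) := by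
    have hR : ∑ a ∈ Finset.Icc 1 (d - 1), (η (a : ZMod d) : ℝ) = 0 := by exact_mod_cast hsumη
    rw [← sub_eq_zero, ← Finset.sum_sub_distrib]
    have : ∀ a ∈ Finset.Icc 1 (d - 1), η (a : ZMod d) • koG (1 - (a : ℝ) / d) -
        Real.log (Real.Gamma (1 - (a : ℝ) / d)) * (η (a : ZMod d) : ℝ) =
        (η (a : ZMod d) : ℝ) * (- (1 / 2 * Real.log Real.pi)) := by
      intro a _
      rw [Rat.smul_def]; unfold koG; ring
    rw [Finset.sum_congr rfl this, ← Finset.sum_mul, hR, zero_mul]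
  rw [e, Real.exp_sum]
  refine Finset.prod_congr rfl fun a ha => ?_
  rw [Real.rpow_def_of_pos (hpos a ha)]
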